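/- arXiv:2108.00125 — 2 statements merged into one kernel-verified Lean document; each statement's English description precedes it below -/
import Mathlib

section
/- For every x ∈ ℝ^n and every d ∈ ℝ^n, the one-sided directional derivative of θ_x at 0 in direction d equals the maximum of the directional derivatives of the objectives, i.e. θ_x′(0; d) = max_{i=1,…,m} F_i′(x; d). -/
open Filter Topology
open scoped RealInnerProductSpace

noncomputable section

/-- `Euc n` is Euclidean `n`-space `ℝ^n`. -/
abbrev Euc (n : ℕ) := EuclideanSpace ℝ (Fin n)

/-- `HasDirDeriv f x d D` : the one-sided directional derivative of `f` at `x`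
in direction `d` exists and equals `D`, i.e. `(f (x + α • d) - f x)/α → D` as `α → 0⁺`. -/
def HasDirDeriv {n : ℕ} (f : Euc n → ℝ) (x d : Euc n) (D : ℝ) : Prop :=
  Filter.Tendsto (fun α : ℝ => (f (x + α • d) - f x) / α)
    (nhdsWithin 0 (Set.Ioi 0)) (nhds D)

/-- `x` is Pareto stationary for the objectives `F i`:
for every direction `d`, `max_i F_i'(x; d) ≥ 0`, i.e. some objective has
nonnegative directional derivative in direction `d`. -/
def ParetoStationary {n m : ℕ} (F : Fin m → Euc n → ℝ) (x : Euc n) : Prop :=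
  ∀ d : Euc n, ∃ i : Fin m, ∃ D : ℝ, HasDirDeriv (F i) x d D ∧ 0 ≤ D

/-- `θ_x(d) = max_i { ⟪∇g_i(x), d⟫ + ½⟪d, B_i(x) d⟫ + h_i(x+d) - h_i(x) }`. -/
def theta {n m : ℕ} (g h : Fin m → Euc n → ℝ)
    (B : Fin m → Euc n → (Euc n →L[ℝ] Euc n)) (x d : Euc n) : ℝ :=
  ⨆ i : Fin m, (⟪gradient (g i) x, d⟫ + (1 / 2) * ⟪d, B i x d⟫ + h i (x + d) - h i x)

/-- `φ_{ω,x}(d) = θ_x(d) + (ω/2)‖d‖²`. -/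
def phi {n m : ℕ} (g h : Fin m → Euc n → ℝ)
    (B : Fin m → Euc n → (Euc n →L[ℝ] Euc n)) (ω : ℝ) (x d : Euc n) : ℝ :=
  theta g h B x d + (ω / 2) * ‖d‖ ^ 2

/-- θ_x′(0; d) = max_{i} F_i′(x; d). -/
theorem theta_dirDeriv_at_zero_eq_max
    {n m : ℕ} (g h : Fin m → Euc n → ℝ)
    (B : Fin m → Euc n → (Euc n →L[ℝ] Euc n))
    (hm : 0 < m)
    (hg : ∀ i, ContDiff ℝ 2 (g i))
    (hsc : ∀ i, ∃ a : ℝ, 0 < a ∧ ∀ x y : Euc n,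
      a * ‖x - y‖ ^ 2 ≤ ⟪gradient (g i) x - gradient (g i) y, x - y⟫)
    (hh : ∀ i, ConvexOn ℝ Set.univ (h i))
    (hBsymm : ∀ i x (u v : Euc n), ⟪B i x u, v⟫ = ⟪u, B i x v⟫)
    (hBpos : ∀ i x (d : Euc n), d ≠ 0 → 0 < ⟪d, B i x d⟫)
    (x d : Euc n) :
    ∃ D : Fin m → ℝ,
      (∀ i, HasDirDeriv (fun y => g i y + h i y) x d (D i)) ∧
      HasDirDeriv (fun e => theta g h B x e) 0 d (⨆ i, D i) := by
  have hne : Nonempty (Fin m) := ⟨⟨0, hm⟩⟩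
  have hconv : ∀ i, ∃ c : ℝ, Tendsto (fun α : ℝ => (h i (x + α • d) - h i x) / α)
      (nhdsWithin 0 (Set.Ioi 0)) (nhds c) := by
    intro i
    have hc : ConvexOn ℝ Set.univ (fun t : ℝ => h i (x + t • d)) := by
      refine ⟨convex_univ, ?_⟩
      intro s _ t _ a b ha hb hab
      have := (hh i).2 (Set.mem_univ (x + s • d)) (Set.mem_univ (x + t • d)) ha hb hab
      have e : x + (a • s + b • t) • d = a • (x + s • d) + b • (x + t • d) := by
        have hx : x = (a + b) • x := by rw [hab, one_smul]
        conv_lhs => rw [hx]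
        simp only [smul_eq_mul]
        module
      simp only [e]
      exact this
    have hd := hc.hasDerivWithinAt_rightDeriv_of_mem_interior (x := 0) (by simp)
    rw [hasDerivWithinAt_iff_tendsto_slope' Set.self_notMem_Ioi] at hd
    refine ⟨_, hd.congr fun α => ?_⟩
    simp [slope_def_field]
  choose c hc using hconv
  have hgrad : ∀ i, Tendsto (fun α : ℝ => (g i (x + α • d) - g i x) / α)
      (nhdsWithin 0 (Set.Ioi 0)) (nhds ⟪gradient (g i) x, d⟫) := by
    intro i
    have h1 : DifferentiableAt ℝ (g i) x := ((hg i).differentiable (by norm_num)) x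
    have h2 := (h1.hasGradientAt.hasFDerivAt.hasLineDerivAt d).tendsto_slope_zero_right
    simp only [InnerProductSpace.toDual_apply_apply] at h2
    refine h2.congr fun α => ?_
    rw [smul_eq_mul]; ring
  refine ⟨fun i => ⟪gradient (g i) x, d⟫ + c i, fun i => ?_, ?_⟩
  · refine ((hgrad i).add (hc i)).congr fun α => ?_
    ring
  · have hpos : ∀ᶠ α : ℝ in nhdsWithin 0 (Set.Ioi 0), 0 < α := self_mem_nhdsWithin
    have hid : Tendsto (fun α : ℝ => α) (nhdsWithin 0 (Set.Ioi 0)) (nhds 0) :=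
      tendsto_id.mono_left nhdsWithin_le_nhds
    have key : ∀ i, Tendsto (fun α : ℝ => ⟪gradient (g i) x, d⟫
        + α * ((1 / 2) * ⟪d, B i x d⟫) + (h i (x + α • d) - h i x) / α)
        (nhdsWithin 0 (Set.Ioi 0)) (nhds (⟪gradient (g i) x, d⟫ + c i)) := by
      intro i
      have := ((tendsto_const_nhds (x := ⟪gradient (g i) x, d⟫)).add
        (hid.mul_const ((1 / 2) * ⟪d, B i x d⟫))).add (hc i)
      simpa using this
    have hs := Tendsto.finset_sup'_nhds_apply (s := Finset.univ) Finset.univ_nonempty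
      (fun i _ => key i)
    simp only [Finset.sup'_univ_eq_ciSup] at hs
    unfold HasDirDeriv
    refine hs.congr' ?_
    filter_upwards [hpos] with α hα
    have h0 : theta g h B x 0 = 0 := by simp [theta]
    rw [h0, sub_zero, zero_add, div_eq_mul_inv (theta g h B x (α • d)) α, theta,
      Real.iSup_mul_of_nonneg (inv_nonneg.mpr hα.le)]
    congr 1
    funext i
    simp only [map_smul, real_inner_smul_left, real_inner_smul_right]
    field_simp
    ring
end
end

section
/- Suppose each gradient ∇g_i is Lipschitz continuous on ℝ^n with constant L, let ω > L/2, and suppose each map x ↦ B_i(x) is continuous with symmetric positive definite values. Let {x^k} ⊂ ℝ^n be defined by x^{k+1} = x^k + d_ω(x^k). If {F_i(x^k)}_k is bounded from below for every i = 1,…,m, then every accumulation point of {x^k} is a Pareto stationary point. -/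
open Filter Topology
open scoped RealInnerProductSpace

noncomputable section

theorem has_deriv_line {n : ℕ} {f : Euc n → ℝ} (hf : Differentiable ℝ f) (x d : Euc n) (t : ℝ) :
    HasDerivAt (fun s : ℝ => f (x + s • d)) ⟪gradient f (x + t • d), d⟫ t := by
  have h1 := (hf (x + t • d)).hasGradientAt.hasFDerivAt
  have h2 : HasDerivAt (fun s : ℝ => x + s • d) d t := by
    simpa using ((hasDerivAt_id t).smul_const d).const_add x
  have := h1.comp_hasDerivAt t h2
  simpa [Function.comp_def] using this

theorem descent_aux {n : ℕ} {f : Euc n → ℝ} (hf : Differentiable ℝ f) (L : NNReal)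
    (hL : LipschitzWith L (gradient f)) (x d : Euc n) :
    f (x + d) ≤ f x + ⟪gradient f x, d⟫ + (L : ℝ) / 2 * ‖d‖ ^ 2 := by
  have key := image_le_of_deriv_right_le_deriv_boundary (a := 0) (b := 1)
    (f := fun s : ℝ => f (x + s • d)) (f' := fun t => ⟪gradient f (x + t • d), d⟫)
    (B := fun s : ℝ => f x + s * ⟪gradient f x, d⟫ + (L : ℝ) / 2 * ‖d‖ ^ 2 * s ^ 2)
    (B' := fun s : ℝ => ⟪gradient f x, d⟫ + (L : ℝ) / 2 * ‖d‖ ^ 2 * (2 * s))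
    (fun t _ => (has_deriv_line hf x d t).continuousAt.continuousWithinAt)
    (fun t _ => (has_deriv_line hf x d t).hasDerivWithinAt)
    (by simp) (by fun_prop)
    (fun t _ => by
      have h1 : HasDerivAt (fun s : ℝ => f x + s * ⟪gradient f x, d⟫) ⟪gradient f x, d⟫ t := by
        simpa using ((hasDerivAt_id t).mul_const ⟪gradient f x, d⟫).const_add (f x)
      have h2 : HasDerivAt (fun s : ℝ => (L : ℝ) / 2 * ‖d‖ ^ 2 * s ^ 2)
          ((L : ℝ) / 2 * ‖d‖ ^ 2 * (2 * t)) t := by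
        simpa using (hasDerivAt_pow 2 t).const_mul ((L : ℝ) / 2 * ‖d‖ ^ 2)
      exact (h1.add h2).hasDerivWithinAt)
    (fun t ht => by
      have h1 : ⟪gradient f (x + t • d) - gradient f x, d⟫ ≤ (L * (t * ‖d‖)) * ‖d‖ := by
        refine (real_inner_le_norm _ _).trans ?_
        gcongr
        have := hL.dist_le_mul (x + t • d) x
        rw [dist_eq_norm, dist_eq_norm] at this
        simpa [norm_smul, abs_of_nonneg ht.1] using this
      rw [inner_sub_left] at h1
      nlinarith)
    (Set.right_mem_Icc.2 zero_le_one)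
  simpa using key

def psiAux {n m : ℕ} (g h : Fin m → Euc n → ℝ)
    (B : Fin m → Euc n → (Euc n →L[ℝ] Euc n)) (i : Fin m) (x d : Euc n) : ℝ :=
  ⟪gradient (g i) x, d⟫ + (1 / 2) * ⟪d, B i x d⟫ + h i (x + d) - h i x

theorem psiAux_le_theta {n m : ℕ} (g h : Fin m → Euc n → ℝ)
    (B : Fin m → Euc n → (Euc n →L[ℝ] Euc n)) (i : Fin m) (x d : Euc n) :
    psiAux g h B i x d ≤ theta g h B x d :=
  le_ciSup (f := fun i => psiAux g h B i x d) (Set.finite_range _).bddAbove i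

theorem theta_eq_psiAux {n m : ℕ} (hm : 0 < m) (g h : Fin m → Euc n → ℝ)
    (B : Fin m → Euc n → (Euc n →L[ℝ] Euc n)) (x d : Euc n) :
    ∃ i, theta g h B x d = psiAux g h B i x d := by
  have : Nonempty (Fin m) := ⟨⟨0, hm⟩⟩
  obtain ⟨i, hi⟩ := exists_eq_ciSup_of_finite (f := fun i => psiAux g h B i x d)
  exact ⟨i, hi.symm⟩

theorem theta_smul_le {n m : ℕ} (hm : 0 < m) (g h : Fin m → Euc n → ℝ)
    (B : Fin m → Euc n → (Euc n →L[ℝ] Euc n))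
    (hh : ∀ i, ConvexOn ℝ Set.univ (h i))
    (hBpos : ∀ i x (d : Euc n), 0 ≤ ⟪d, B i x d⟫) (x d : Euc n) (t : ℝ)
    (h0 : 0 ≤ t) (h1 : t ≤ 1) :
    theta g h B x (t • d) ≤ t * theta g h B x d := by
  obtain ⟨i, hi⟩ := theta_eq_psiAux hm g h B x (t • d)
  rw [hi]
  refine le_trans ?_ (mul_le_mul_of_nonneg_left (psiAux_le_theta g h B i x d) h0)
  unfold psiAux
  have hc := (hh i).2 (Set.mem_univ x) (Set.mem_univ (x + d)) (sub_nonneg.2 h1) h0 (by ring)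
  have he : (1 - t) • x + t • (x + d) = x + t • d := by module
  rw [he] at hc
  simp only [smul_eq_mul] at hc
  simp only [map_smul, inner_smul_left, inner_smul_right, RCLike.conj_to_real]
  have : t * (t * ⟪d, B i x d⟫) ≤ t * ⟪d, B i x d⟫ := by
    refine mul_le_mul_of_nonneg_left ?_ h0
    nlinarith [hBpos i x d]
  nlinarith

/-- the minimizer satisfies `θ(d) ≤ -ω ‖d‖²` -/
theorem theta_min_le {n m : ℕ} (hm : 0 < m) (g h : Fin m → Euc n → ℝ)
    (B : Fin m → Euc n → (Euc n →L[ℝ] Euc n))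
    (hh : ∀ i, ConvexOn ℝ Set.univ (h i))
    (hBpos : ∀ i x (d : Euc n), 0 ≤ ⟪d, B i x d⟫) (ω : ℝ) (x d : Euc n)
    (hmin : ∀ e, phi g h B ω x d ≤ phi g h B ω x e) :
    theta g h B x d ≤ - ω * ‖d‖ ^ 2 := by
  have key : ∀ t ∈ Set.Ico (0:ℝ) 1, theta g h B x d + ω / 2 * (1 + t) * ‖d‖ ^ 2 ≤ 0 := by
    intro t ht
    have h1 := hmin (t • d)
    have h2 := theta_smul_le hm g h B hh hBpos x d t ht.1 ht.2.le
    unfold phi at h1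
    rw [norm_smul, mul_pow, Real.norm_eq_abs, sq_abs] at h1
    have h3 : 0 < 1 - t := sub_pos.2 ht.2
    by_contra hcon
    push Not at hcon
    nlinarith [mul_pos h3 hcon]
  have hlim : Tendsto (fun t : ℝ => theta g h B x d + ω / 2 * (1 + t) * ‖d‖ ^ 2)
      (𝓝[<] 1) (𝓝 (theta g h B x d + ω / 2 * (1 + 1) * ‖d‖ ^ 2)) := by
    apply Tendsto.mono_left _ nhdsWithin_le_nhds
    apply Continuous.tendsto
    fun_prop
  have := le_of_tendsto hlim (by
    filter_upwards [Ico_mem_nhdsLT (zero_lt_one' ℝ)] with t ht using key t ht)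
  linarith

theorem dirDeriv_exists {n : ℕ} {f : Euc n → ℝ} (hf : ConvexOn ℝ Set.univ f) (x d : Euc n) :
    ∃ D, HasDirDeriv f x d D := by
  have hc : ConvexOn ℝ Set.univ (fun s : ℝ => f (x + s • d)) := by
    refine ⟨convex_univ, fun s _ t _ a b ha hb hab => ?_⟩
    have := hf.2 (Set.mem_univ (x + s • d)) (Set.mem_univ (x + t • d)) ha hb hab
    have he : a • (x + s • d) + b • (x + t • d) = x + (a • s + b • t) • d := by
      have : x = (a + b) • x := by rw [hab, one_smul]
      conv_rhs => rw [this]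
      simp only [smul_eq_mul]
      module
    rwa [he] at this
  have h1 := hc.hasDerivWithinAt_rightDeriv_of_mem_interior (x := 0) (by simp)
  rw [hasDerivWithinAt_iff_tendsto_slope' (by simp)] at h1
  refine ⟨_, h1.congr fun t => ?_⟩
  simp [slope_def_field]

theorem dirDeriv_smooth {n : ℕ} {f : Euc n → ℝ} (hf : Differentiable ℝ f) (x d : Euc n) :
    HasDirDeriv f x d ⟪gradient f x, d⟫ := by
  have h1 := (has_deriv_line hf x d 0).hasDerivWithinAt (s := Set.Ioi 0)
  rw [hasDerivWithinAt_iff_tendsto_slope' (by simp)] at h1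
  simp only [zero_smul, add_zero] at h1
  refine h1.congr fun t => ?_
  simp [slope_def_field]

/-- every accumulation point of the sequence generated by the
proximal quasi-Newton method without line searches is Pareto stationary. -/
theorem algorithm_two_accumulation_stationary
    {n m : ℕ} (g h : Fin m → Euc n → ℝ)
    (B : Fin m → Euc n → (Euc n →L[ℝ] Euc n))
    (hm : 0 < m)
    (hg : ∀ i, ContDiff ℝ 2 (g i))
    (hsc : ∀ i, ∃ a : ℝ, 0 < a ∧ ∀ x y : Euc n,
      a * ‖x - y‖ ^ 2 ≤ ⟪gradient (g i) x - gradient (g i) y, x - y⟫)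
    (hh : ∀ i, ConvexOn ℝ Set.univ (h i))
    (hBsymm : ∀ i x (u v : Euc n), ⟪B i x u, v⟫ = ⟪u, B i x v⟫)
    (hBpos : ∀ i x (d : Euc n), d ≠ 0 → 0 < ⟪d, B i x d⟫)
    (hBcont : ∀ i, Continuous (fun x => B i x))
    (L : NNReal) (hL : ∀ i, LipschitzWith L (gradient (g i)))
    (ω : ℝ) (hω : (L : ℝ) / 2 < ω)
    (dω : Euc n → Euc n)
    (hmin : ∀ y d, phi g h B ω y (dω y) ≤ phi g h B ω y d)
    (huniq : ∀ y d, (∀ d', phi g h B ω y d ≤ phi g h B ω y d') → d = dω y)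
    (x : ℕ → Euc n)
    (hstep : ∀ k, x (k + 1) = x k + dω (x k))
    (hbdd : ∀ i, ∃ C : ℝ, ∀ k, C ≤ g i (x k) + h i (x k)) :
    ∀ a : Euc n, MapClusterPt a atTop x →
      ParetoStationary (fun i y => g i y + h i y) a := by
  intro a ha d
  have hgd : ∀ i, Differentiable ℝ (g i) := fun i => (hg i).differentiable (by norm_num)
  have hB0 : ∀ i x (d : Euc n), 0 ≤ ⟪d, B i x d⟫ := by
    intro i x d
    by_cases hd : d = 0
    · simp [hd]
    · exact (hBpos i x d hd).le
  have hhc : ∀ i, Continuous (h i) := fun i =>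
    continuousOn_univ.1 ((hh i).continuousOn isOpen_univ)
  have hgc : ∀ i, Continuous (gradient (g i)) := fun i => (hL i).continuous
  -- sufficient decrease
  have hdec : ∀ i k, (ω - L / 2) * ‖dω (x k)‖ ^ 2 ≤
      (g i (x k) + h i (x k)) - (g i (x (k + 1)) + h i (x (k + 1))) := by
    intro i k
    have h1 := theta_min_le hm g h B hh hB0 ω (x k) (dω (x k)) (hmin (x k))
    have h2 := psiAux_le_theta g h B i (x k) (dω (x k))
    have h3 := descent_aux (hgd i) L (hL i) (x k) (dω (x k))
    have h4 := hB0 i (x k) (dω (x k))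
    unfold psiAux at h2
    rw [hstep k]
    linarith
  let i0 : Fin m := ⟨0, hm⟩
  have hd0 : Tendsto (fun k => dω (x k)) atTop (𝓝 0) := by
    have hpos : 0 < ω - L / 2 := sub_pos.2 hω
    have hanti : Antitone (fun k => g i0 (x k) + h i0 (x k)) := by
      apply antitone_nat_of_succ_le
      intro k
      have := hdec i0 k
      have : 0 ≤ (ω - L / 2) * ‖dω (x k)‖ ^ 2 := by positivity
      linarith
    obtain ⟨C, hC⟩ := hbdd i0
    have hconv := tendsto_atTop_ciInf hanti ⟨C, by rintro _ ⟨k, rfl⟩; exact hC k⟩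
    have hdiff := hconv.sub (hconv.comp (tendsto_add_atTop_nat 1))
    rw [sub_self] at hdiff
    have h1 : Tendsto (fun k => (ω - L / 2) * ‖dω (x k)‖ ^ 2) atTop (𝓝 0) :=
      squeeze_zero (fun k => by positivity) (fun k => hdec i0 k) hdiff
    have h2 : Tendsto (fun k => ‖dω (x k)‖ ^ 2) atTop (𝓝 0) := by
      have := h1.const_mul (ω - L / 2)⁻¹
      rw [mul_zero] at this
      refine this.congr fun k => ?_
      exact inv_mul_cancel_left₀ hpos.ne' _
    have h3 := h2.sqrt
    rw [Real.sqrt_zero] at h3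
    rw [tendsto_zero_iff_norm_tendsto_zero]
    refine h3.congr fun k => ?_
    exact Real.sqrt_sq (norm_nonneg _)
  obtain ⟨s, hs, hsa⟩ := ha.tendsto_subseq
  have hpc : ∀ i, Continuous (fun p : Euc n × Euc n =>
      psiAux g h B i p.1 p.2 + ω / 2 * ‖p.2‖ ^ 2) := by
    intro i
    have h1 := hgc i
    have h2 := hhc i
    have h3 := hBcont i
    have h4 : Continuous (fun p : Euc n × Euc n => B i p.1 p.2) :=
      (h3.comp continuous_fst).clm_apply continuous_snd
    unfold psiAux
    fun_prop
  -- the limit point: zero minimizes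
  have hlim : ∀ e, ∃ i, 0 ≤ psiAux g h B i a e + ω / 2 * ‖e‖ ^ 2 := by
    intro e
    by_contra hcon
    push Not at hcon
    have hl0 : Tendsto (fun k => psiAux g h B i0 (x (s k)) (dω (x (s k)))
        + ω / 2 * ‖dω (x (s k))‖ ^ 2) atTop (𝓝 0) := by
      have h1 := ((hpc i0).tendsto (a, 0)).comp
        (hsa.prodMk_nhds (hd0.comp hs.tendsto_atTop))
      have h2 : psiAux g h B i0 a 0 + ω / 2 * ‖(0 : Euc n)‖ ^ 2 = 0 := by simp [psiAux]
      simp only [h2] at h1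
      exact h1
    have hli : ∀ i, ∀ᶠ k in atTop, psiAux g h B i (x (s k)) e + ω / 2 * ‖e‖ ^ 2 <
        psiAux g h B i0 (x (s k)) (dω (x (s k))) + ω / 2 * ‖dω (x (s k))‖ ^ 2 := by
      intro i
      have h1 := ((hpc i).tendsto (a, e)).comp
        (hsa.prodMk_nhds (tendsto_const_nhds (x := e)))
      exact h1.eventually_lt hl0 (hcon i)
    obtain ⟨k, hk⟩ := (eventually_all.2 hli).exists
    obtain ⟨i, hi⟩ := theta_eq_psiAux hm g h B (x (s k)) e
    have h1 := hmin (x (s k)) e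
    have h2 := psiAux_le_theta g h B i0 (x (s k)) (dω (x (s k)))
    have h3 := hk i
    unfold phi at h1
    linarith
  choose D hD using fun i => dirDeriv_exists (hh i) a d
  have hG := fun i => dirDeriv_smooth (hgd i) a d
  have hF : ∀ i, HasDirDeriv (fun y => g i y + h i y) a d (⟪gradient (g i) a, d⟫ + D i) := by
    intro i
    refine Tendsto.congr (fun t => ?_) ((hG i).add (hD i))
    ring
  by_contra hcon
  push Not at hcon
  have hneg : ∀ i, ⟪gradient (g i) a, d⟫ + D i < 0 := fun i => hcon i _ (hF i)
  have hev : ∀ i, ∀ᶠ t : ℝ in 𝓝[>] 0,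
      psiAux g h B i a (t • d) + ω / 2 * ‖t • d‖ ^ 2 < 0 := by
    intro i
    have h1 : Tendsto (fun t : ℝ => t * (1 / 2 * ⟪d, B i a d⟫ + ω / 2 * ‖d‖ ^ 2)) (𝓝[>] 0)
        (𝓝 0) := by
      have : Continuous (fun t : ℝ => t * (1 / 2 * ⟪d, B i a d⟫ + ω / 2 * ‖d‖ ^ 2)) := by
        fun_prop
      have h := this.tendsto 0
      rw [zero_mul] at h
      exact h.mono_left nhdsWithin_le_nhds
    have h2 := ((hD i).const_add ⟪gradient (g i) a, d⟫).add h1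
    rw [add_zero] at h2
    filter_upwards [h2.eventually_lt_const (hneg i), self_mem_nhdsWithin] with t ht ht0
    have ht0 : 0 < t := ht0
    have h3 := mul_neg_of_pos_of_neg ht0 ht
    have h4 : psiAux g h B i a (t • d) + ω / 2 * ‖t • d‖ ^ 2 =
        t * (⟪gradient (g i) a, d⟫ + (h i (a + t • d) - h i a) / t +
          t * (1 / 2 * ⟪d, B i a d⟫ + ω / 2 * ‖d‖ ^ 2)) := by
      unfold psiAux
      rw [norm_smul, mul_pow, Real.norm_eq_abs, sq_abs]
      simp only [map_smul, inner_smul_left, inner_smul_right, RCLike.conj_to_real]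
      field_simp
      ring
    rw [h4]
    exact h3
  obtain ⟨t, ht⟩ := (eventually_all.2 hev).exists
  obtain ⟨i, hi⟩ := hlim (t • d)
  exact absurd (ht i) (not_lt.2 hi)
end
end
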